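/- arXiv:1110.1020 — 2 statements merged into one kernel-verified Lean document; each statement's English description precedes it below -/
import Mathlib

section
/- Let ℂⁿ = H_S ⊕ H_R be an orthogonal decomposition with orthogonal projections Π_S and Π_R = I − Π_S. Let H ∈ M_n(ℂ) be Hermitian and L_1, …, L_r ∈ M_n(ℂ) satisfy Π_R L_k Π_S = 0 for every k and Π_S (i·H − (1/2)·Σ_k L_k† L_k) Π_R = 0. Then for every density matrix ρ, the function t ↦ trace(Π_R · exp(t𝓛)(ρ)) is nonincreasing on [0, ∞). -/
open scoped Matrix ComplexOrder

noncomputable section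

attribute [local instance] Matrix.normedAddCommGroup Matrix.normedSpace

abbrev Mat (n : ℕ) := Matrix (Fin n) (Fin n) ℂ

/-- The Lindblad generator `𝓛(ρ) = −i[H,ρ] + Σ_k (L_k ρ L_k† − ½(L_k† L_k ρ + ρ L_k† L_k))`. -/
def lindblad {n r : ℕ} (H : Mat n) (L : Fin r → Mat n) : Mat n →ₗ[ℂ] Mat n :=
  (-Complex.I) • (LinearMap.mulLeft ℂ H - LinearMap.mulRight ℂ H)
    + ∑ k, ((LinearMap.mulRight ℂ (L k)ᴴ).comp (LinearMap.mulLeft ℂ (L k))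
        - (1/2 : ℂ) • (LinearMap.mulLeft ℂ ((L k)ᴴ * L k)
            + LinearMap.mulRight ℂ ((L k)ᴴ * L k)))

/-- `evol H L t ρ = exp (t 𝓛) ρ`, the solution of the master equation at time `t`. -/
def evol {n r : ℕ} (H : Mat n) (L : Fin r → Mat n) (t : ℝ) (ρ : Mat n) : Mat n :=
  haveI : IsTopologicalRing (Mat n →L[ℂ] Mat n) :=
    @NonUnitalSeminormedRing.toIsTopologicalRing _
      (ContinuousLinearMap.toSeminormedRing (𝕜 := ℂ) (E := Mat n)).toNonUnitalSeminormedRing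
  NormedSpace.exp ((t : ℂ) • (lindblad H L).toContinuousLinearMap) ρ

section SemigroupPositivity

/-- A telescoping estimate for the difference of two powers in a normed ring. -/
theorem norm_pow_sub_pow_le_of_norm_le {𝔸 : Type*} [NormedRing 𝔸] [NormOneClass 𝔸] {a b : 𝔸}
    {M : ℝ} (hM : 1 ≤ M) (ha : ‖a‖ ≤ M) (hb : ‖b‖ ≤ M) (n : ℕ) :
    ‖a ^ n - b ^ n‖ ≤ n * M ^ n * ‖a - b‖ := by
  have hM0 : 0 ≤ M := zero_le_one.trans hM
  induction n with
  | zero => simp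
  | succ n ih =>
    have hsplit : a ^ (n + 1) - b ^ (n + 1) = a ^ n * (a - b) + (a ^ n - b ^ n) * b := by
      rw [pow_succ, pow_succ]; noncomm_ring
    have han : ‖a ^ n‖ ≤ M ^ (n + 1) :=
      (norm_pow_le a n).trans <| (pow_le_pow_left₀ (norm_nonneg a) ha n).trans
        (pow_le_pow_right₀ hM n.le_succ)
    calc ‖a ^ (n + 1) - b ^ (n + 1)‖
        ≤ ‖a ^ n * (a - b)‖ + ‖(a ^ n - b ^ n) * b‖ := by rw [hsplit]; exact norm_add_le _ _
      _ ≤ M ^ (n + 1) * ‖a - b‖ + (n * M ^ n * ‖a - b‖) * M := by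
          refine add_le_add ((norm_mul_le _ _).trans ?_) ((norm_mul_le _ _).trans ?_) <;> gcongr
      _ = (n + 1 : ℕ) * M ^ (n + 1) * ‖a - b‖ := by push_cast; ring

/-- The exponential in a Banach algebra is bounded by the exponential of the norm. -/
theorem norm_exp_le_exp_norm_of_normedAlgebra {𝔸 : Type*} [NormedRing 𝔸] [NormOneClass 𝔸]
    [NormedAlgebra ℂ 𝔸] [CompleteSpace 𝔸] (a : 𝔸) :
    ‖NormedSpace.exp a‖ ≤ Real.exp ‖a‖ := by
  rw [NormedSpace.exp_eq_tsum ℂ, Real.exp_eq_exp_ℝ]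
  refine tsum_of_norm_bounded (NormedSpace.exp_series_hasSum_exp' (𝕂 := ℝ) ‖a‖) fun k => ?_
  rw [norm_smul, norm_inv, Complex.norm_natCast, smul_eq_mul]
  gcongr
  exact norm_pow_le a k

open Filter Topology in
/-- Powers of a second-order perturbation of the Euler step converge to the exponential. -/
theorem tendsto_one_add_smul_add_sq_smul_pow {𝔸 : Type*} [NormedRing 𝔸] [NormOneClass 𝔸]
    [NormedAlgebra ℂ 𝔸] [CompleteSpace 𝔸] (a q : 𝔸) {t : ℝ} (ht : 0 ≤ t) :
    Tendsto (fun N : ℕ => (1 + ((t / N : ℝ) : ℂ) • a + ((t / N : ℝ) : ℂ) ^ 2 • q) ^ N) atTop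
      (𝓝 (NormedSpace.exp ((t : ℂ) • a))) := by
  let euler : ℝ → 𝔸 := fun ε => 1 + (ε : ℂ) • a + (ε : ℂ) ^ 2 • q
  let flow : ℝ → 𝔸 := fun ε => NormedSpace.exp ((ε : ℂ) • a)
  have hofReal : HasDerivAt (fun ε : ℝ => (ε : ℂ)) 1 0 := Complex.ofRealCLM.hasDerivAt
  have heuler : HasDerivAt euler a 0 := by
    have h := ((hofReal.smul_const a).const_add (1 : 𝔸)).add ((hofReal.pow 2).smul_const q)
    convert! h using 1
    simp
  have hflow : HasDerivAt flow a 0 := by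
    have h := (hasDerivAt_exp_smul_const a ((0 : ℝ) : ℂ)).scomp (0 : ℝ) hofReal
    simpa [flow, Function.comp_def] using h
  have hstep : Tendsto (fun N : ℕ => t / (N : ℝ)) atTop (𝓝 0) :=
    tendsto_const_div_atTop_nhds_zero_nat t
  have herror : (fun ε => euler ε - flow ε) =o[𝓝 0] fun ε => ε := by
    simpa [euler, flow] using (heuler.sub hflow).isLittleO
  have hscaled : Tendsto (fun N : ℕ => (N : ℝ) * ‖euler (t / N) - flow (t / N)‖) atTop (𝓝 0) := by
    have h := (Asymptotics.isBigO_refl (fun N : ℕ => (N : ℝ)) atTop).mul_isLittleO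
      (herror.comp_tendsto hstep).norm_left
    refine (Asymptotics.isLittleO_one_iff ℝ).1 (h.trans_isBigO ?_)
    refine Asymptotics.IsBigO.of_bound t ?_
    filter_upwards [eventually_gt_atTop 0] with N hN
    have hN' : (N : ℝ) ≠ 0 := by positivity
    simp [mul_div_cancel₀, hN', abs_of_nonneg ht]
  let c : ℝ := ‖a‖ + ‖q‖
  have hc : 0 ≤ c := by positivity
  have hbound : ∀ᶠ N : ℕ in atTop, ‖euler (t / N) ^ N - flow (t / N) ^ N‖
      ≤ Real.exp (t * c) * ((N : ℝ) * ‖euler (t / N) - flow (t / N)‖) := by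
    filter_upwards [eventually_gt_atTop 0, hstep.eventually (gt_mem_nhds one_pos)] with N hN hlt
    set ε : ℝ := t / N with hε
    have hε0 : 0 ≤ ε := by positivity
    have hnorm : ‖(ε : ℂ)‖ = ε := by simp [abs_of_nonneg hε0]
    have hE : ‖euler ε‖ ≤ Real.exp (ε * c) := by
      calc ‖euler ε‖ ≤ 1 + ε * ‖a‖ + ε ^ 2 * ‖q‖ := by
            refine (norm_add₃_le).trans_eq ?_
            rw [norm_one, norm_smul, norm_smul, norm_pow, hnorm]
        _ ≤ ε * c + 1 := by
            nlinarith [mul_nonneg (mul_nonneg hε0 (norm_nonneg q)) (sub_nonneg.2 hlt.le)]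
        _ ≤ Real.exp (ε * c) := Real.add_one_le_exp _
    have hF : ‖flow ε‖ ≤ Real.exp (ε * c) := by
      refine (norm_exp_le_exp_norm_of_normedAlgebra _).trans (Real.exp_le_exp.2 ?_)
      rw [norm_smul, hnorm]
      gcongr
      simp [c]
    have hpow : Real.exp (ε * c) ^ N = Real.exp (t * c) := by
      rw [← Real.exp_nat_mul, hε]
      congr 1
      field_simp
    refine (norm_pow_sub_pow_le_of_norm_le (Real.one_le_exp (by positivity)) hE hF N).trans_eq ?_
    rw [hpow]
    ring
  have hflow_pow : ∀ᶠ N : ℕ in atTop, flow (t / N) ^ N = flow t := by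
    filter_upwards [eventually_gt_atTop 0] with N hN
    let : NormedAlgebra ℚ 𝔸 := NormedAlgebra.restrictScalars ℚ ℂ 𝔸
    have hN' : (N : ℂ) ≠ 0 := by exact_mod_cast hN.ne'
    simp only [flow]
    rw [← NormedSpace.exp_nsmul, ← Nat.cast_smul_eq_nsmul ℂ, smul_smul]
    congr 2
    push_cast
    field_simp
  have hdiff : Tendsto (fun N : ℕ => euler (t / N) ^ N - flow (t / N) ^ N) atTop (𝓝 0) :=
    squeeze_zero_norm' hbound (by simpa using hscaled.const_mul (Real.exp (t * c)))
  have h := hdiff.add (tendsto_const_nhds.congr' (hflow_pow.mono fun _ h => h.symm))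
  simpa only [sub_add_cancel, zero_add] using h

/-- A closed set invariant under second-order perturbations `1 + ε A + ε² Q` of the Euler step
is invariant under the semigroup generated by `A`. -/
theorem exp_smul_apply_mem_of_euler_step_mem {E : Type*} [NormedAddCommGroup E] [NormedSpace ℂ E]
    [CompleteSpace E] {S : Set E} (hS : IsClosed S) (A Q : E →L[ℂ] E)
    (hstep : ∀ ε : ℝ, 0 ≤ ε → ∀ x ∈ S, x + (ε : ℂ) • A x + (ε : ℂ) ^ 2 • Q x ∈ S)
    {t : ℝ} (ht : 0 ≤ t) {x : E} (hx : x ∈ S) :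
    NormedSpace.exp ((t : ℂ) • A) x ∈ S := by
  rcases subsingleton_or_nontrivial E with _ | _
  · rwa [Subsingleton.elim (NormedSpace.exp ((t : ℂ) • A) x) x]
  have h := ((ContinuousLinearMap.apply ℂ E x).continuous.tendsto _).comp
    (tendsto_one_add_smul_add_sq_smul_pow A Q ht)
  refine hS.mem_of_tendsto h (.of_forall fun N => ?_)
  have hpow : ∀ k : ℕ,
      ((1 + ((t / N : ℝ) : ℂ) • A + ((t / N : ℝ) : ℂ) ^ 2 • Q) ^ k) x ∈ S := by
    intro k
    induction k with
    | zero => simpa using hx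
    | succ k ih =>
      rw [pow_succ', mul_apply_eq_comp]
      exact hstep _ (by positivity) _ ih
  exact hpow N

/-- Orbits of the semigroup generated by `A` solve the differential equation `x' = A x`. -/
theorem hasDerivAt_exp_ofReal_smul_apply {E : Type*} [NormedAddCommGroup E] [NormedSpace ℂ E]
    [CompleteSpace E] (A : E →L[ℂ] E) (x : E) (t : ℝ) :
    HasDerivAt (fun s : ℝ => NormedSpace.exp ((s : ℂ) • A) x)
      (A (NormedSpace.exp ((t : ℂ) • A) x)) t := by
  have hofReal : HasDerivAt (fun s : ℝ => (s : ℂ)) 1 t := Complex.ofRealCLM.hasDerivAt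
  have h := (hasDerivAt_exp_smul_const' A (t : ℂ)).scomp t hofReal
  have h' := ((ContinuousLinearMap.apply ℂ E x).restrictScalars ℝ).hasFDerivAt.comp_hasDerivAt t h
  simpa [Function.comp_def] using h'

end SemigroupPositivity

section Lindblad

theorem isClosed_setOf_posSemidef (n : ℕ) : IsClosed {M : Mat n | M.PosSemidef} := by
  simp only [Matrix.posSemidef_iff_dotProduct_mulVec, Matrix.IsHermitian, Set.ofPred_and,
    Set.ofPred_forall]
  refine (isClosed_eq ?_ continuous_id).inter (isClosed_iInter fun x => isClosed_le ?_ ?_)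
  all_goals fun_prop

variable {n r : ℕ}

theorem lindblad_apply (H : Mat n) (L : Fin r → Mat n) (ρ : Mat n) :
    lindblad H L ρ = (-Complex.I) • (H * ρ - ρ * H)
      + ∑ k, (L k * ρ * (L k)ᴴ
        - (1 / 2 : ℂ) • ((L k)ᴴ * L k * ρ + ρ * ((L k)ᴴ * L k))) := by
  simp [lindblad, mul_assoc]

/-- The Lindblad generator as a sum of a completely positive map and `ρ ↦ K ρ + ρ K†`. -/
theorem lindblad_apply_eq {H : Mat n} (L : Fin r → Mat n) {K : Mat n}
    (hK : K = -(Complex.I • H) - (1 / 2 : ℂ) • ∑ k, (L k)ᴴ * L k) (hH : H.IsHermitian)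
    (ρ : Mat n) :
    lindblad H L ρ = K * ρ + ρ * Kᴴ + ∑ k, L k * ρ * (L k)ᴴ := by
  have hKH : Kᴴ = Complex.I • H - (1 / 2 : ℂ) • ∑ k, (L k)ᴴ * L k := by
    simp [hK, Matrix.conjTranspose_sum, hH.eq]
  rw [lindblad_apply, hKH, hK]
  simp only [Finset.sum_sub_distrib, ← Finset.smul_sum, Finset.sum_add_distrib,
    ← Finset.sum_mul, ← Finset.mul_sum, sub_mul, mul_sub, neg_mul, smul_mul_assoc,
    mul_smul_comm, smul_sub, smul_add, neg_smul]
  abel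

theorem evol_posSemidef {H : Mat n} (hH : H.IsHermitian) (L : Fin r → Mat n) {t : ℝ}
    (ht : 0 ≤ t) {ρ : Mat n} (hρ : ρ.PosSemidef) : (evol H L t ρ).PosSemidef := by
  set K : Mat n := -(Complex.I • H) - (1 / 2 : ℂ) • ∑ k, (L k)ᴴ * L k with hK
  let Q : Mat n →ₗ[ℂ] Mat n := (LinearMap.mulRight ℂ Kᴴ).comp (LinearMap.mulLeft ℂ K)
  refine exp_smul_apply_mem_of_euler_step_mem (isClosed_setOf_posSemidef n)
    (lindblad H L).toContinuousLinearMap Q.toContinuousLinearMap (fun ε hε σ hσ => ?_) ht hρ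
  have hsplit : σ + (ε : ℂ) • lindblad H L σ + (ε : ℂ) ^ 2 • Q σ
      = (1 + (ε : ℂ) • K) * σ * (1 + (ε : ℂ) • K)ᴴ + (ε : ℂ) • ∑ k, L k * σ * (L k)ᴴ := by
    rw [lindblad_apply_eq L hK hH]
    simp only [Q, LinearMap.comp_apply, LinearMap.mulLeft_apply, LinearMap.mulRight_apply,
      Matrix.conjTranspose_add, Matrix.conjTranspose_one, Matrix.conjTranspose_smul,
      Complex.star_def, Complex.conj_ofReal, add_mul, mul_add, one_mul, mul_one, smul_mul_assoc,
      mul_smul_comm]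
    module
  change (σ + (ε : ℂ) • lindblad H L σ + (ε : ℂ) ^ 2 • Q σ).PosSemidef
  rw [hsplit]
  have hσ' : σ.PosSemidef := hσ
  exact (hσ'.mul_mul_conjTranspose_same _).add
    ((Matrix.posSemidef_sum _ fun k _ => hσ'.mul_mul_conjTranspose_same (L k)).smul
      (by exact_mod_cast hε))

/-- The adjoint of a generator `ρ ↦ K ρ + ρ K† + Σ_k L_k ρ L_k†`, applied to the projection onto
the complement of an invariant subspace. -/
theorem adjoint_generator_compl_eq {PS : Mat n} (hPH : PS.IsHermitian) (hPidem : PS * PS = PS)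
    {K : Mat n} {L : Fin r → Mat n} (hsum : K + Kᴴ = -∑ k, (L k)ᴴ * L k)
    (hLQ : ∀ k, (1 - PS) * L k * PS = 0) (hinv : PS * Kᴴ * (1 - PS) = 0) :
    Kᴴ * (1 - PS) + (1 - PS) * K + ∑ k, (L k)ᴴ * (1 - PS) * L k
      = -∑ k, (PS * L k * (1 - PS))ᴴ * (PS * L k * (1 - PS)) := by
  set R : Mat n := 1 - PS with hR
  have hRH : Rᴴ = R := by simp [hR, hPH.eq]
  have hRR : R * R = R := by rw [hR]; noncomm_ring; rw [hPidem]; abel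
  have hPS : PS = 1 - R := by rw [hR]; abel
  have hKR : Kᴴ * R = R * Kᴴ * R := by
    rw [hPS] at hinv
    simpa [sub_mul, sub_eq_zero] using hinv
  have hRK : R * K = R * K * R := by
    simpa [hRH, Matrix.mul_assoc] using congrArg Matrix.conjTranspose hKR
  have hRL : ∀ k, R * L k = R * L k * R := fun k => by
    have h := hLQ k
    rw [hPS] at h
    simpa [mul_sub, sub_eq_zero] using h
  have hLR : ∀ k, (L k)ᴴ * R = R * (L k)ᴴ * R := fun k => by
    simpa [hRH, Matrix.mul_assoc] using congrArg Matrix.conjTranspose (hRL k)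
  have hjump : ∀ k, (L k)ᴴ * R * L k
      = R * ((L k)ᴴ * L k) * R - (PS * L k * R)ᴴ * (PS * L k * R) := fun k => by
    have h1 : (L k)ᴴ * R * L k = R * (L k)ᴴ * R * L k * R := by
      calc (L k)ᴴ * R * L k = (L k)ᴴ * R * (R * L k) := by
            rw [← mul_assoc, mul_assoc _ R R, hRR]
        _ = R * (L k)ᴴ * R * (R * L k * R) := by rw [← hLR, ← hRL]
        _ = R * (L k)ᴴ * (R * R) * L k * R := by noncomm_ring
        _ = R * (L k)ᴴ * R * L k * R := by rw [hRR]
    have h2 : (PS * L k * R)ᴴ * (PS * L k * R) = R * (L k)ᴴ * (PS * PS) * L k * R := by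
      simp only [Matrix.conjTranspose_mul, hRH, hPH.eq]
      noncomm_ring
    rw [h1, h2, hPidem, hPS]
    noncomm_ring
  have h : Kᴴ * R + R * K = R * (K + Kᴴ) * R := by
    rw [hKR, hRK]; noncomm_ring
  rw [h, hsum]
  simp only [hjump, Finset.sum_sub_distrib, ← Finset.sum_mul, ← Finset.mul_sum]
  noncomm_ring

theorem trace_mul_lindblad {H : Mat n} (L : Fin r → Mat n) {K : Mat n}
    (hK : K = -(Complex.I • H) - (1 / 2 : ℂ) • ∑ k, (L k)ᴴ * L k) (hH : H.IsHermitian)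
    (R ρ : Mat n) :
    (R * lindblad H L ρ).trace
      = ((Kᴴ * R + R * K + ∑ k, (L k)ᴴ * R * L k) * ρ).trace := by
  rw [lindblad_apply_eq L hK hH]
  simp only [mul_add, add_mul, Matrix.trace_add, Finset.mul_sum, Finset.sum_mul,
    Matrix.trace_sum]
  have h1 : (R * (ρ * Kᴴ)).trace = (Kᴴ * R * ρ).trace := by
    rw [← mul_assoc, Matrix.trace_mul_comm, mul_assoc]
  have h2 : ∀ k, (R * (L k * ρ * (L k)ᴴ)).trace = ((L k)ᴴ * R * L k * ρ).trace := fun k => by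
    rw [← mul_assoc, Matrix.trace_mul_comm]
    simp only [mul_assoc]
  simp only [h1, h2, mul_assoc R K]
  ring

/-- Under the invariance conditions the trace of the generator over the complement of the
invariant subspace is minus a sum of transition rates. -/
theorem trace_compl_mul_lindblad {PS : Mat n} (hPH : PS.IsHermitian) (hPidem : PS * PS = PS)
    {H : Mat n} (hH : H.IsHermitian) {L : Fin r → Mat n}
    (hLQ : ∀ k, (1 - PS) * L k * PS = 0)
    (hinv : PS * (Complex.I • H - (1/2 : ℂ) • ∑ k, (L k)ᴴ * L k) * (1 - PS) = 0)
    (ρ : Mat n) :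
    ((1 - PS) * lindblad H L ρ).trace
      = -∑ k, ((PS * L k * (1 - PS)) * ρ * (PS * L k * (1 - PS))ᴴ).trace := by
  obtain ⟨K, hK⟩ : ∃ K : Mat n, K = -(Complex.I • H) - (1 / 2 : ℂ) • ∑ k, (L k)ᴴ * L k := ⟨_, rfl⟩
  have hKH : Kᴴ = Complex.I • H - (1 / 2 : ℂ) • ∑ k, (L k)ᴴ * L k := by
    simp [hK, Matrix.conjTranspose_sum, hH.eq]
  rw [← hKH] at hinv
  have hsum : K + Kᴴ = -∑ k, (L k)ᴴ * L k := by
    rw [hKH, hK]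
    module
  have hdual := adjoint_generator_compl_eq hPH hPidem hsum hLQ hinv
  rw [trace_mul_lindblad L hK hH, hdual, neg_mul, Matrix.trace_neg, Finset.sum_mul,
    Matrix.trace_sum]
  refine congrArg Neg.neg (Finset.sum_congr rfl fun k _ => ?_)
  rw [Matrix.trace_mul_comm (PS * L k * (1 - PS) * ρ), mul_assoc _ _ ρ]

theorem trace_compl_mul_lindblad_nonpos {PS : Mat n} (hPH : PS.IsHermitian)
    (hPidem : PS * PS = PS) {H : Mat n} (hH : H.IsHermitian) {L : Fin r → Mat n}
    (hLQ : ∀ k, (1 - PS) * L k * PS = 0)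
    (hinv : PS * (Complex.I • H - (1/2 : ℂ) • ∑ k, (L k)ᴴ * L k) * (1 - PS) = 0)
    {ρ : Mat n} (hρ : ρ.PosSemidef) :
    ((1 - PS) * lindblad H L ρ).trace ≤ 0 := by
  rw [trace_compl_mul_lindblad hPH hPidem hH hLQ hinv, neg_nonpos]
  exact Finset.sum_nonneg fun k _ => (hρ.mul_mul_conjTranspose_same _).trace_nonneg

theorem hasDerivAt_trace_mul_evol (R H : Mat n) (L : Fin r → Mat n) (ρ : Mat n) (t : ℝ) :
    HasDerivAt (fun s : ℝ => (R * evol H L s ρ).trace)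
      (R * lindblad H L (evol H L t ρ)).trace t := by
  let T : Mat n →L[ℂ] ℂ :=
    ((Matrix.traceLinearMap (Fin n) ℂ ℂ).comp (LinearMap.mulLeft ℂ R)).toContinuousLinearMap
  exact (T.restrictScalars ℝ).hasFDerivAt.comp_hasDerivAt t
    (hasDerivAt_exp_ofReal_smul_apply (lindblad H L).toContinuousLinearMap ρ t)

end Lindblad

/-- A complex-valued function with nonpositive derivative (in the partial order of `ℂ`) is
antitone. -/
theorem antitoneOn_Ici_of_hasDerivAt_complex_nonpos {f f' : ℝ → ℂ} {a : ℝ}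
    (hf : ∀ t, HasDerivAt f (f' t) t) (hf' : ∀ t, a ≤ t → f' t ≤ 0) :
    AntitoneOn f (Set.Ici a) := by
  have hanti : ∀ T : ℂ →L[ℝ] ℝ, (∀ z : ℂ, z ≤ 0 → T z ≤ 0) →
      AntitoneOn (fun t => T (f t)) (Set.Ici a) := by
    intro T hT
    have hTf : ∀ t, HasDerivAt (fun s => T (f s)) (T (f' t)) t := fun t =>
      T.hasFDerivAt.comp_hasDerivAt t (hf t)
    refine antitoneOn_of_hasDerivWithinAt_nonpos (convex_Ici a)
      (fun t _ => (hTf t).continuousAt.continuousWithinAt)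
      (fun t _ => (hTf t).hasDerivWithinAt) fun t ht => hT _ (hf' t (interior_subset ht))
  intro s hs t ht hst
  have hre := hanti Complex.reCLM (fun z hz => (Complex.le_def.1 hz).1) hs ht hst
  have him := hanti Complex.imCLM (fun z hz => (Complex.le_def.1 hz).2.le) hs ht hst
  have him' := hanti (-Complex.imCLM) (fun z hz => by simp [(Complex.le_def.1 hz).2]) hs ht hst
  simp only [Complex.reCLM_apply, Complex.imCLM_apply, neg_apply] at hre him him'
  exact Complex.le_def.2 ⟨hre, by linarith⟩

/-- Under the invariance conditions for `H_S`, for every density matrix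
`ρ` the function `t ↦ tr(Π_R exp(t𝓛)(ρ))` is nonincreasing on `[0, ∞)`. -/
theorem trace_R_antitone {n r : ℕ}
    (PS : Mat n) (hPH : PS.IsHermitian) (hPidem : PS * PS = PS)
    (H : Mat n) (hH : H.IsHermitian) (L : Fin r → Mat n)
    (hLQ : ∀ k, (1 - PS) * L k * PS = 0)
    (hinv : PS * (Complex.I • H - (1/2 : ℂ) • ∑ k, (L k)ᴴ * L k) * (1 - PS) = 0) :
    ∀ ρ : Mat n, ρ.PosSemidef → ρ.trace = 1 →
      AntitoneOn (fun t : ℝ => ((1 - PS) * evol H L t ρ).trace) (Set.Ici 0) := by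
  intro ρ hρ _
  exact antitoneOn_Ici_of_hasDerivAt_complex_nonpos
    (hasDerivAt_trace_mul_evol (1 - PS) H L ρ) fun t ht =>
      trace_compl_mul_lindblad_nonpos hPH hPidem hH hLQ hinv (evol_posSemidef hH L ht hρ)
end
end

section
/- Let H ∈ M_n(ℂ) be Hermitian and L_1, …, L_r ∈ M_n(ℂ), with Lindblad generator 𝓛. Let X be a nonempty set of density matrices that is invariant for the master equation, i.e. exp(t𝓛)(ρ) ∈ X for every ρ ∈ X and every t ≥ 0. Then there exists a density matrix ρ* belonging to the closure of the convex hull of X such that 𝓛(ρ*) = 0 (an invariant state). -/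
open scoped Matrix ComplexOrder

noncomputable section

attribute [local instance] Matrix.normedAddCommGroup Matrix.normedSpace

/-- A bounded forward trajectory of the autonomous linear equation `du/dt = A u` has an equilibrium in
the closed convex hull of any bounded set containing it: a limit point of the time averages. -/
theorem exists_mem_closure_convexHull_map_eq_zero {E : Type*} [NormedAddCommGroup E]
    [NormedSpace ℝ E] [ProperSpace E] (A : E →L[ℝ] E) {X : Set E} (hX : Bornology.IsBounded X)
    {u : ℝ → E} (hu : ∀ t, HasDerivAt u (A (u t)) t) (huX : ∀ t, 0 ≤ t → u t ∈ X) :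
    ∃ x ∈ closure (convexHull ℝ X), A x = 0 := by
  have hcont : Continuous u := continuous_iff_continuousAt.2 fun t => (hu t).continuousAt
  have hintegrable (a b : ℝ) : IntervalIntegrable u MeasureTheory.volume a b :=
    hcont.intervalIntegrable a b
  set y : ℕ → E := fun k => ⨍ t in (0 : ℝ)..(k + 1 : ℝ), u t with hy
  have hpos (k : ℕ) : (0 : ℝ) < k + 1 := by positivity
  have hymem (k : ℕ) : y k ∈ closure (convexHull ℝ X) := by
    refine (convex_convexHull ℝ X).set_average_mem_closure ?_ ?_ ?_ ?_
    · simp [Set.uIoc_of_le (hpos k).le, hpos k]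
    · simp [Set.uIoc_of_le (hpos k).le]
    · refine (MeasureTheory.ae_restrict_iff' measurableSet_uIoc).2 (.of_forall fun t ht => ?_)
      rw [Set.uIoc_of_le (hpos k).le] at ht
      exact subset_convexHull ℝ X (huX t ht.1.le)
    · exact hcont.integrableOn_uIoc
  have hAy (k : ℕ) : A (y k) = (k + 1 : ℝ)⁻¹ • (u (k + 1) - u 0) := by
    simp only [hy, interval_average_eq, map_smul, sub_zero]
    rw [← A.intervalIntegral_comp_comm (hintegrable _ _),
      intervalIntegral.integral_eq_sub_of_hasDerivAt (fun t _ => hu t)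
        ((A.continuous.comp hcont).intervalIntegrable _ _)]
  obtain ⟨C, hC⟩ := hX.exists_norm_le
  have hAlim : Filter.Tendsto (fun k => A (y k)) Filter.atTop (nhds 0) := by
    have hbound : Filter.Tendsto (fun k : ℕ => (k + 1 : ℝ)⁻¹ * (C + C)) Filter.atTop (nhds 0) := by
      simpa using (tendsto_one_div_add_atTop_nhds_zero_nat (𝕜 := ℝ)).mul_const (C + C)
    refine squeeze_zero_norm (fun k => ?_) hbound
    rw [hAy, norm_smul, Real.norm_of_nonneg (inv_pos.2 (hpos k)).le]
    gcongr
    exact (norm_sub_le _ _).trans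
      (add_le_add (hC _ (huX _ (hpos k).le)) (hC _ (huX _ le_rfl)))
  have hcompact : IsCompact (closure (convexHull ℝ X)) :=
    (isBounded_convexHull.2 hX).isCompact_closure
  obtain ⟨x, hx, φ, hφ, hlim⟩ := hcompact.tendsto_subseq hymem
  exact ⟨x, hx, tendsto_nhds_unique ((A.continuous.tendsto x).comp hlim)
    (hAlim.comp hφ.tendsto_atTop)⟩

theorem Matrix.PosSemidef.norm_apply_sq_le {ι : Type*} {M : Matrix ι ι ℂ}
    (hM : M.PosSemidef) (i j : ι) : ‖M i j‖ ^ 2 ≤ ‖M i i‖ * ‖M j j‖ := by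
  have hdet := (hM.submatrix ![i, j]).det_nonneg
  have hji : M j i = star (M i j) := (hM.isHermitian.apply j i).symm
  have hi := Complex.norm_of_nonneg' (hM.diag_nonneg (i := i))
  have hj := Complex.norm_of_nonneg' (hM.diag_nonneg (i := j))
  simp only [Matrix.det_fin_two, Matrix.submatrix_apply, Matrix.cons_val_zero,
    Matrix.cons_val_one, hji, Complex.star_def, Complex.mul_conj'] at hdet
  rw [← hi, ← hj, sub_nonneg] at hdet
  exact_mod_cast hdet

theorem Matrix.PosSemidef.norm_diag_le_one {ι : Type*} [Fintype ι] {M : Matrix ι ι ℂ}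
    (hM : M.PosSemidef) (htr : M.trace = 1) (i : ι) : ‖M i i‖ ≤ 1 := by
  have hle : M i i ≤ 1 := htr ▸ Finset.single_le_sum (f := fun k => M k k)
    (fun _ _ => hM.diag_nonneg) (Finset.mem_univ i)
  rw [← Complex.norm_of_nonneg' (hM.diag_nonneg (i := i))] at hle
  exact_mod_cast hle

theorem Matrix.PosSemidef.norm_le_one {ι : Type*} [Fintype ι] {M : Matrix ι ι ℂ}
    (hM : M.PosSemidef) (htr : M.trace = 1) : ‖M‖ ≤ 1 := by
  refine (Matrix.norm_le_iff zero_le_one).2 fun i j => ?_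
  refine (sq_le_one_iff₀ (norm_nonneg _)).1 ((hM.norm_apply_sq_le i j).trans ?_)
  exact mul_le_one₀ (hM.norm_diag_le_one htr i) (norm_nonneg _) (hM.norm_diag_le_one htr j)

theorem isClosed_setOf_density {ι : Type*} [Fintype ι] :
    IsClosed {M : Matrix ι ι ℂ | M.PosSemidef ∧ M.trace = 1} := by
  simp only [Matrix.posSemidef_iff_dotProduct_mulVec, Set.ofPred_and, Set.ofPred_forall]
  refine .inter (.inter ?_ (isClosed_iInter fun x => ?_)) ?_
  · exact isClosed_eq continuous_id.matrix_conjTranspose continuous_id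
  · exact isClosed_le continuous_const (by fun_prop)
  · exact isClosed_eq continuous_id.matrix_trace continuous_const

theorem convex_setOf_density {ι : Type*} [Fintype ι] :
    Convex ℝ {M : Matrix ι ι ℂ | M.PosSemidef ∧ M.trace = 1} := by
  intro M hM N hN a b ha hb hab
  refine ⟨(hM.1.smul ha).add (hN.1.smul hb), ?_⟩
  rw [Matrix.trace_add, Matrix.trace_smul, Matrix.trace_smul, hM.2, hN.2, ← add_smul, hab,
    one_smul]

theorem hasDerivAt_evol {n r : ℕ} (H : Mat n) (L : Fin r → Mat n) (ρ : Mat n) (t : ℝ) :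
    HasDerivAt (fun s => evol H L s ρ) (lindblad H L (evol H L t ρ)) t :=
  hasDerivAt_exp_ofReal_smul_apply (lindblad H L).toContinuousLinearMap ρ t

/-- If a nonempty set `X` of density matrices is invariant for the
master equation, then the closure of its convex hull contains an invariant state
`ρ*` with `𝓛(ρ*) = 0`. -/
theorem invariant_state_in_closed_convex_hull {n r : ℕ}
    (H : Mat n) (hH : H.IsHermitian) (L : Fin r → Mat n)
    (X : Set (Mat n)) (hne : X.Nonempty)
    (hX : ∀ ρ ∈ X, ρ.PosSemidef ∧ ρ.trace = 1)
    (hinvX : ∀ ρ ∈ X, ∀ t : ℝ, 0 ≤ t → evol H L t ρ ∈ X) :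
    ∃ ρstar ∈ closure (convexHull ℝ X),
      ρstar.PosSemidef ∧ ρstar.trace = 1 ∧ lindblad H L ρstar = 0 := by
  obtain ⟨ρ, hρ⟩ := hne
  have hbdd : Bornology.IsBounded X :=
    isBounded_iff_forall_norm_le.2 ⟨1, fun M hM => (hX M hM).1.norm_le_one (hX M hM).2⟩
  obtain ⟨ρstar, hmem, hzero⟩ := exists_mem_closure_convexHull_map_eq_zero
    ((lindblad H L).toContinuousLinearMap.restrictScalars ℝ) hbdd
    (hasDerivAt_evol H L ρ) (hinvX ρ hρ)
  have hdensity := closure_minimal (convexHull_min hX convex_setOf_density)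
    isClosed_setOf_density hmem
  exact ⟨ρstar, hmem, hdensity.1, hdensity.2, hzero⟩
end
end
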